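/- Let X and Y be metric spaces and suppose there exists a quasi-isometry f : X → Y. If X is quasi-straightenable, then Y is quasi-straightenable. Quantitatively: if f is an (L,C)-quasi-isometry with L ≥ 1, C ≥ 0 and X is K-quasi-straightenable, then Y is K″-quasi-straightenable for some K″ depending only on L, C, K. -/

import Mathlib

/-- For `K ≥ 0`, a bi-infinite sequence `ζ : ℤ → X` in a metric space is a `K`-quasi-straight
sequence if `ζ(ℤ≤0)` and `ζ(ℤ≥0)` are unbounded, consecutive points are at distance at most
`1 + K`, and the sequence is quantitatively almost aligned. -/
def IsQuasiStraightSeq {X : Type*} [MetricSpace X] (K : ℝ) (ζ : ℤ → X) : Prop :=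
  ¬ Bornology.IsBounded (ζ '' {k : ℤ | k ≤ 0}) ∧
  ¬ Bornology.IsBounded (ζ '' {k : ℤ | 0 ≤ k}) ∧
  (∀ k : ℤ, dist (ζ k) (ζ (k + 1)) ≤ 1 + K) ∧
  ∀ i j k : ℤ, i ≤ j → j ≤ k →
    dist (ζ i) (ζ j) + dist (ζ j) (ζ k) - dist (ζ i) (ζ k) ≤ K * dist (ζ i) (ζ k) + K

/-- A metric space is `K`-quasi-straightenable if every two points lie in the open
`K`-neighborhood of (the image of) some `K`-quasi-straight sequence. -/
def IsQuasiStraightenable (X : Type*) [MetricSpace X] (K : ℝ) : Prop :=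
  ∀ x y : X, ∃ ζ : ℤ → X, IsQuasiStraightSeq K ζ ∧
    x ∈ ⋃ k : ℤ, Metric.ball (ζ k) K ∧ y ∈ ⋃ k : ℤ, Metric.ball (ζ k) K

/-- For `L ≥ 1` and `C ≥ 0`, a map between metric spaces is an `(L,C)`-quasi-isometry if it
distorts distances by at most the affine factors `(L, C)` and its image is `C`-dense. -/
def IsQuasiIsometry {X Y : Type*} [MetricSpace X] [MetricSpace Y]
    (L C : ℝ) (f : X → Y) : Prop :=
  (∀ x₁ x₂ : X,
      (1 / L) * dist x₁ x₂ - C ≤ dist (f x₁) (f x₂) ∧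
      dist (f x₁) (f x₂) ≤ L * dist x₁ x₂ + C) ∧
  ∀ y : Y, ∃ x : X, dist (f x) y ≤ C

namespace IsQuasiIsometry

variable {X Y : Type*} [MetricSpace X] [MetricSpace Y] {L C : ℝ} {f : X → Y}

theorem dist_le (hf : IsQuasiIsometry L C f) (hL : 0 < L) (x₁ x₂ : X) :
    dist x₁ x₂ ≤ L * (dist (f x₁) (f x₂) + C) := by
  have h := (hf.1 x₁ x₂).1
  rw [one_div, sub_le_iff_le_add, inv_mul_le_iff₀ hL] at h
  exact h

theorem isBounded_of_isBounded_image (hf : IsQuasiIsometry L C f) (hL : 0 < L) {s : Set X}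
    (hs : Bornology.IsBounded (f '' s)) : Bornology.IsBounded s := by
  obtain ⟨M, hM⟩ := Metric.isBounded_iff.1 hs
  refine Metric.isBounded_iff.2 ⟨L * (M + C), fun x hx y hy => (hf.dist_le hL x y).trans ?_⟩
  gcongr
  exact hM (Set.mem_image_of_mem f hx) (Set.mem_image_of_mem f hy)

theorem isQuasiStraightSeq_comp (hf : IsQuasiIsometry L C f) (hL : 1 ≤ L) (hC : 0 ≤ C)
    {K : ℝ} (hK : 0 ≤ K) {ζ : ℤ → X} (hζ : IsQuasiStraightSeq K ζ) :
    IsQuasiStraightSeq (L ^ 2 * (1 + K) * (1 + C) + L * K + 2 * C) (f ∘ ζ) := by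
  have hL0 : 0 < L := by linarith
  obtain ⟨hneg, hpos, hstep, halign⟩ := hζ
  refine ⟨fun h => hneg ?_, fun h => hpos ?_, fun k => ?_, fun i j k hij hjk => ?_⟩
  · rw [Set.image_comp] at h
    exact hf.isBounded_of_isBounded_image hL0 h
  · rw [Set.image_comp] at h
    exact hf.isBounded_of_isBounded_image hL0 h
  · have h : L * dist (ζ k) (ζ (k + 1)) ≤ L ^ 2 * (1 + K) := by
      calc L * dist (ζ k) (ζ (k + 1)) ≤ L * (1 + K) := by gcongr; exact hstep k
        _ ≤ L ^ 2 * (1 + K) := by gcongr; exact le_self_pow₀ hL two_ne_zero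
    have hLC : 0 ≤ L ^ 2 * (1 + K) * C := by positivity
    have hLK : 0 ≤ L * K := by positivity
    have hfk := (hf.1 (ζ k) (ζ (k + 1))).2
    simp only [Function.comp_apply]
    linarith
  · simp only [Function.comp_apply]
    have hsum : L * (dist (ζ i) (ζ j) + dist (ζ j) (ζ k)) ≤
        L * ((1 + K) * (L * (dist (f (ζ i)) (f (ζ k)) + C)) + K) := by
      refine mul_le_mul_of_nonneg_left ?_ hL0.le
      calc dist (ζ i) (ζ j) + dist (ζ j) (ζ k) ≤ (1 + K) * dist (ζ i) (ζ k) + K := by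
            linarith [halign i j k hij hjk]
        _ ≤ _ := by gcongr; exact hf.dist_le hL0 _ _
    have hfij := (hf.1 (ζ i) (ζ j)).2
    have hfjk := (hf.1 (ζ j) (ζ k)).2
    have hd : 0 ≤ dist (f (ζ i)) (f (ζ k)) := dist_nonneg
    have hconst : 0 ≤ L ^ 2 * (1 + K) := by positivity
    have hrest : 0 ≤ (L ^ 2 * (1 + K) * C + L * K + 2 * C) * dist (f (ζ i)) (f (ζ k)) := by
      positivity
    linarith

theorem mem_iUnion_ball_comp (hf : IsQuasiIsometry L C f) (hL : 0 < L) {ι : Type*} {K : ℝ}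
    {ζ : ι → X} {x : X} {y : Y} (hxy : dist (f x) y ≤ C) (hx : x ∈ ⋃ k, Metric.ball (ζ k) K) :
    y ∈ ⋃ k, Metric.ball ((f ∘ ζ) k) (L * K + 2 * C) := by
  obtain ⟨k, hk⟩ := Set.mem_iUnion.1 hx
  refine Set.mem_iUnion.2 ⟨k, ?_⟩
  rw [Metric.mem_ball] at hk ⊢
  have h : L * dist x (ζ k) < L * K := mul_lt_mul_of_pos_left hk hL
  have hfk := (hf.1 x (ζ k)).2
  have htri := dist_triangle_left y (f (ζ k)) (f x)
  simp only [Function.comp_apply]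
  linarith

theorem isQuasiStraightenable (hf : IsQuasiIsometry L C f) (hL : 1 ≤ L) (hC : 0 ≤ C)
    {K : ℝ} (hK : 0 ≤ K) (hX : IsQuasiStraightenable X K) :
    IsQuasiStraightenable Y (L ^ 2 * (1 + K) * (1 + C) + L * K + 2 * C) := by
  intro y₁ y₂
  obtain ⟨x₁, hx₁⟩ := hf.2 y₁
  obtain ⟨x₂, hx₂⟩ := hf.2 y₂
  obtain ⟨ζ, hζ, h₁, h₂⟩ := hX x₁ x₂
  have hL0 : 0 < L := by linarith
  have hle : L * K + 2 * C ≤ L ^ 2 * (1 + K) * (1 + C) + L * K + 2 * C := by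
    have : 0 ≤ L ^ 2 * (1 + K) * (1 + C) := by positivity
    linarith
  have hsub := Set.iUnion_mono fun k => Metric.ball_subset_ball (x := (f ∘ ζ) k) hle
  exact ⟨f ∘ ζ, hf.isQuasiStraightSeq_comp hL hC hK hζ,
    hsub (hf.mem_iUnion_ball_comp hL0 hx₁ h₁), hsub (hf.mem_iUnion_ball_comp hL0 hx₂ h₂)⟩

end IsQuasiIsometry

/-- Quasi-straightenability is preserved under quasi-isometries, quantitatively:
if `f : X → Y` is an `(L,C)`-quasi-isometry and `X` is `K`-quasi-straightenable, then `Y` is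
`K''`-quasi-straightenable for some `K'' ≥ 0` depending only on `L`, `C`, `K`. -/
theorem quasiStraightenable_of_quasiIsometry.{u, v} :
    ∃ κ : ℝ → ℝ → ℝ → ℝ,
      ∀ {X : Type u} {Y : Type v} [MetricSpace X] [MetricSpace Y]
        (L C K : ℝ), 1 ≤ L → 0 ≤ C → 0 ≤ K →
        ∀ f : X → Y, IsQuasiIsometry L C f →
        IsQuasiStraightenable X K →
        0 ≤ κ L C K ∧ IsQuasiStraightenable Y (κ L C K) := by
  refine ⟨fun L C K => L ^ 2 * (1 + K) * (1 + C) + L * K + 2 * C, ?_⟩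
  intro X Y _ _ L C K hL hC hK f hf hX
  have hL0 : 0 < L := by linarith
  exact ⟨by positivity, hf.isQuasiStraightenable hL hC hK hX⟩
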